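/- Let H be a graph with disjoint distinguished ordered tuples of vertices U and V such that every vertex of H outside U ∪ V has degree at least one. Let t = |V(H)|, let z = |V(H) \ (U ∪ V)|, and let q be the minimum size of a vertex separator of U and V in H. (1) If q + z ≥ 1, then for all ε ∈ (0,1), the probability that ‖R_H‖ ≥ 2·t^t·(e·(t+z)·(ln(8·n^q/ε)/(2(q+z)) + 1))^{q+z} · n^{(t−q)/2} is at most ε. (2) If q = z = 0, then ‖R_H‖ ≤ n^{t/2} for every g ∈ Ω. -/

import Mathlib

noncomputable def opNorm {α β : Type*} [Fintype α] [Fintype β] [DecidableEq β]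
    (M : Matrix α β ℝ) : ℝ :=
  ‖LinearMap.toContinuousLinearMap (Matrix.toEuclideanLin M)‖

def sgn (b : Bool) : ℝ := if b then 1 else -1

noncomputable def Pr {n : ℕ} (P : (Sym2 (Fin n) → Bool) → Prop) : ℝ := by
  classical
  exact ((Finset.univ.filter P).card : ℝ) / (Fintype.card (Sym2 (Fin n) → Bool))

noncomputable def Ex {n : ℕ} (f : (Sym2 (Fin n) → Bool) → ℝ) : ℝ :=
  (∑ g : Sym2 (Fin n) → Bool, f g) / (Fintype.card (Sym2 (Fin n) → Bool))

noncomputable def Rmat {n : ℕ} (g : Sym2 (Fin n) → Bool) : Matrix (Fin n) (Fin n) ℝ :=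
  Matrix.of fun i j => if i = j then 0 else sgn (g s(i, j))

def cyc {m : ℕ} (j : Fin m) : Fin m := ⟨((j : ℕ) + 1) % m, Nat.mod_lt _ j.pos⟩

abbrev SubsetsCard (n x : ℕ) := {A : Finset (Fin n) // A.card = x}

def tup {n x : ℕ} (A : SubsetsCard n x) (i : Fin x) : Fin n :=
  (A.1.orderIsoOfFin A.2 i : Fin n)

noncomputable def RH {n x y : ℕ} (E : Finset (Fin x × Fin y)) (g : Sym2 (Fin n) → Bool) :
    Matrix (SubsetsCard n x) (SubsetsCard n y) ℝ :=
  Matrix.of fun A B =>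
    if Disjoint A.1 B.1 then ∏ e ∈ E, sgn (g s(tup A e.1, tup B e.2)) else 0

def IsVertexCover {x y : ℕ} (E : Finset (Fin x × Fin y)) (S : Finset (Fin x ⊕ Fin y)) : Prop :=
  ∀ e ∈ E, Sum.inl e.1 ∈ S ∨ Sum.inr e.2 ∈ S

def IsSep {x y z : ℕ} (H : SimpleGraph (Fin x ⊕ Fin y ⊕ Fin z))
    (S : Finset (Fin x ⊕ Fin y ⊕ Fin z)) : Prop :=
  ∀ (i : Fin x) (j : Fin y) (p : H.Walk (Sum.inl i) (Sum.inr (Sum.inl j))),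
    ∃ s ∈ S, s ∈ p.support

noncomputable def RHgen {n x y z : ℕ} (H : SimpleGraph (Fin x ⊕ Fin y ⊕ Fin z))
    [DecidableRel H.Adj] (g : Sym2 (Fin n) → Bool) :
    Matrix (SubsetsCard n x) (SubsetsCard n y) ℝ :=
  Matrix.of fun A B =>
    if Disjoint A.1 B.1 then
      ∑ C : Fin z ↪ Fin n,
        if ∀ m, C m ∉ A.1 ∧ C m ∉ B.1 then
          ∏ e ∈ H.edgeFinset,
            sgn (g (Sym2.map (Sum.elim (tup A) (Sum.elim (tup B) ⇑C)) e))
        else 0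
    else 0

open Finset

/-- `WeightedReach H I d v c`: some walk of `H` from a vertex satisfying `I` to `v` has total
`d`-weight `c`, both endpoints included. -/
inductive WeightedReach {V : Type*} (H : SimpleGraph V) (I : V → Prop) (d : V → ℕ) :
    V → ℕ → Prop
  | start (u : V) (hu : I u) : WeightedReach H I d u (d u)
  | step (a b : V) (c : ℕ) (ha : WeightedReach H I d a c) (hab : H.Adj a b) :
      WeightedReach H I d b (c + d b)

/-- The vertices at which the weighted distance from `I` crosses the level `τ`. -/
def levelCut {V : Type*} (H : SimpleGraph V) (I : V → Prop) (d : V → ℕ) (τ : ℕ) : Set V :=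
  {v | (∃ c, WeightedReach H I d v c ∧ c < τ + d v) ∧ ∀ c, WeightedReach H I d v c → τ ≤ c}

theorem exists_mem_levelCut_of_walk {V : Type*} {H : SimpleGraph V} {I : V → Prop} {d : V → ℕ}
    {τ : ℕ} {u v : V} (p : H.Walk u v)
    (hu : ∃ c, WeightedReach H I d u c ∧ c < τ + d u)
    (hv : ∀ c, WeightedReach H I d v c → τ ≤ c) :
    ∃ s ∈ p.support, s ∈ levelCut H I d τ := by
  induction p with
  | nil => exact ⟨_, by simp, hu, hv⟩
  | @cons a b w hab p ih =>
    by_cases h : ∀ c, WeightedReach H I d a c → τ ≤ c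
    · exact ⟨a, by simp, hu, h⟩
    · push Not at h
      obtain ⟨c, hc, hlt⟩ := h
      obtain ⟨s, hs, hs'⟩ := ih ⟨c + d b, .step _ _ _ hc hab, by omega⟩ hv
      exact ⟨s, by simp [hs], hs'⟩

/-- If every walk from `I` to `O` has weight at least `m`, and every `I`-`O` separator has at least
`q` vertices, then the total weight is at least `q * m`. -/
theorem mul_le_sum_of_weightedReach {V : Type*} [Fintype V] {H : SimpleGraph V}
    {I O : V → Prop} {d : V → ℕ} {q m : ℕ}
    (hsep : ∀ S : Finset V,
      (∀ u v, I u → O v → ∀ p : H.Walk u v, ∃ s ∈ S, s ∈ p.support) → q ≤ S.card)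
    (hm : ∀ v c, O v → WeightedReach H I d v c → m ≤ c) :
    q * m ≤ ∑ v, d v := by
  classical
  let L : ℕ → Finset V := fun τ => univ.filter (· ∈ levelCut H I d τ)
  have hL : ∀ τ ∈ Icc 1 m, q ≤ (L τ).card := by
    intro τ hτ
    rw [mem_Icc] at hτ
    refine hsep _ fun u v hu hv p => ?_
    obtain ⟨s, hs, hs'⟩ := exists_mem_levelCut_of_walk (I := I) (d := d) (τ := τ) p
      ⟨_, .start u hu, by omega⟩ (fun c hc => hτ.2.trans (hm v c hv hc))
    exact ⟨s, by simp [L, hs'], hs⟩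
  calc q * m = ∑ τ ∈ Icc 1 m, q := by simp [mul_comm]
    _ ≤ ∑ τ ∈ Icc 1 m, (L τ).card := sum_le_sum hL
    _ = ∑ v, ((Icc 1 m).filter fun τ => v ∈ levelCut H I d τ).card := by
        simp only [L, card_filter]
        exact sum_comm
    _ ≤ ∑ v, d v := by
        refine sum_le_sum fun v _ => ?_
        by_cases h : ∃ c, WeightedReach H I d v c
        · have h0 := Nat.find_spec h
          have hmin := fun c hc => Nat.find_min' h (m := c) hc
          set c₀ := Nat.find h
          calc _ ≤ (Ico (c₀ + 1 - d v) (c₀ + 1)).card := by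
                refine card_le_card fun τ hτ => ?_
                obtain ⟨-, ⟨c, hc, hlt⟩, hall⟩ := mem_filter.1 hτ
                have := hall _ h0
                have := hmin _ hc
                rw [mem_Ico]
                omega
            _ ≤ d v := by
                rw [Nat.card_Ico]
                omega
        · rw [filter_eq_empty_iff.2]
          · simp
          · rintro τ - ⟨⟨c, hc, -⟩, -⟩
            exact h ⟨c, hc⟩

/-- The functions on `S` that factor through `f`. -/
def factorSubmodule {S β : Type*} (f : S → β) : Submodule ℚ (S → ℚ) where
  carrier := {h | ∀ s s', f s = f s' → h s = h s'}
  add_mem' ha hb s s' e := by simp [ha s s' e, hb s s' e]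
  zero_mem' := by simp
  smul_mem' c h hh s s' e := by simp [hh s s' e]

theorem finrank_factorSubmodule {S β : Type*} [Fintype S] [DecidableEq β] (f : S → β) :
    Module.finrank ℚ (factorSubmodule f) = (univ.image f).card := by
  let g : S → univ.image f := fun s => ⟨f s, by simp⟩
  have hg : Function.Surjective g := by
    rintro ⟨b, hb⟩
    obtain ⟨s, -, rfl⟩ := mem_image.1 hb
    exact ⟨s, rfl⟩
  have hr : factorSubmodule f = LinearMap.range (LinearMap.funLeft ℚ ℚ g) := by
    ext h
    constructor
    · intro hh
      refine ⟨fun b => h (hg b).choose, ?_⟩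
      ext s
      exact hh _ _ (congrArg Subtype.val (hg (g s)).choose_spec)
    · rintro ⟨k, rfl⟩ s s' e
      simp only [LinearMap.funLeft_apply]
      congr 1
      exact Subtype.ext e
  rw [hr, LinearMap.finrank_range_of_inj (LinearMap.funLeft_injective_of_surjective ℚ ℚ g hg)]
  simp

theorem two_mul_card_image_le {S β : Type*} [Fintype S] [DecidableEq β] (f : S → β)
    (hf : ∀ s, ∃ s', s' ≠ s ∧ f s' = f s) : 2 * (univ.image f).card ≤ Fintype.card S := by
  refine mul_card_image_le_card univ 2 fun b hb => ?_
  obtain ⟨s, -, rfl⟩ := mem_image.1 hb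
  obtain ⟨s', hs, hs'⟩ := hf s
  exact one_lt_card.2 ⟨s', by simp [hs'], s, by simp, hs⟩

/-- Let `f` label copies `s : S` of the vertices of `H`, so that every labelled edge is repeated. Then
the functions on `S` that are constant along the labels met by a walk of weight `c` form a space of
dimension at least `k - c`. -/
theorem exists_submodule_of_weightedReach {V S β : Type*} [Fintype S] [DecidableEq β]
    {H : SimpleGraph V} {I : V → Prop} (f : S → V → β) (k : ℕ)
    (hS : Fintype.card S = 2 * k)
    (hk : ∀ v, (univ.image (f · v)).card ≤ k)
    (hedge : ∀ a b, H.Adj a b → ∀ s, ∃ s', s' ≠ s ∧ f s' a = f s a ∧ f s' b = f s b)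
    {v : V} {c : ℕ} (hr : WeightedReach H I (fun v => k - (univ.image (f · v)).card) v c) :
    ∃ u, I u ∧ ∃ W : Submodule ℚ (S → ℚ), W ≤ factorSubmodule (f · u) ∧
      W ≤ factorSubmodule (f · v) ∧ k ≤ Module.finrank ℚ W + c := by
  induction hr with
  | start u hu =>
    refine ⟨u, hu, factorSubmodule (f · u), le_rfl, le_rfl, ?_⟩
    rw [finrank_factorSubmodule]
    omega
  | step a b c _ hab ih =>
    obtain ⟨u, hu, W, hWu, hWa, hW⟩ := ih
    refine ⟨u, hu, W ⊓ factorSubmodule (f · b), inf_le_left.trans hWu, inf_le_right, ?_⟩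
    have hsum := Submodule.finrank_sup_add_finrank_inf_eq W (factorSubmodule (f · b))
    have hle : W ⊔ factorSubmodule (f · b) ≤ factorSubmodule fun s => (f s a, f s b) := by
      refine sup_le (fun h hh s s' e => hWa hh s s' ?_) (fun h hh s s' e => hh s s' ?_)
      · exact (Prod.ext_iff.1 e).1
      · exact (Prod.ext_iff.1 e).2
    have h1 := Submodule.finrank_mono hle
    have h2 := two_mul_card_image_le (fun s => (f s a, f s b)) fun s => by
      obtain ⟨s', h, h', h''⟩ := hedge a b hab s
      exact ⟨s', h, by simp [h', h'']⟩
    rw [finrank_factorSubmodule] at h1 hsum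
    have := hk b
    omega

theorem sum_card_image_add_mul_le {V S β : Type*} [Fintype V] [Fintype S] [DecidableEq β]
    {H : SimpleGraph V} {I O : V → Prop} (f : S → V → β) (k q : ℕ)
    (hS : Fintype.card S = 2 * k)
    (hk : ∀ v, (univ.image (f · v)).card ≤ k)
    (hedge : ∀ a b, H.Adj a b → ∀ s, ∃ s', s' ≠ s ∧ f s' a = f s a ∧ f s' b = f s b)
    (hconn : ∀ u v, I u → O v → ∀ h : S → ℚ, h ∈ factorSubmodule (f · u) →
      h ∈ factorSubmodule (f · v) → ∀ s s', h s = h s')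
    (hsep : ∀ T : Finset V,
      (∀ u v, I u → O v → ∀ p : H.Walk u v, ∃ s ∈ T, s ∈ p.support) → q ≤ T.card) :
    ∑ v, (univ.image (f · v)).card + q * (k - 1) ≤ k * Fintype.card V := by
  have h := mul_le_sum_of_weightedReach (H := H) (I := I) (O := O)
    (d := fun v => k - (univ.image (f · v)).card) (q := q) (m := k - 1) hsep ?_
  · calc _ ≤ ∑ v, (univ.image (f · v)).card + ∑ v, (k - (univ.image (f · v)).card) := by gcongr
      _ = ∑ v : V, k := by
        rw [← sum_add_distrib]
        exact sum_congr rfl fun v _ => Nat.add_sub_cancel' (hk v)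
      _ = k * Fintype.card V := by simp [mul_comm]
  · intro v c hv hr
    obtain ⟨u, hu, W, hWu, hWv, hW⟩ := exists_submodule_of_weightedReach f k hS hk hedge hr
    have hW1 : W ≤ factorSubmodule fun _ : S => () :=
      fun h hh s s' _ => hconn u v hu hv h (hWu hh) (hWv hh) s s'
    have h1 := Submodule.finrank_mono hW1
    rw [finrank_factorSubmodule] at h1
    have h2 : (univ.image fun _ : S => ()).card ≤ 1 := card_le_univ _
    omega

/-- An upper bound for the number of functions taking at most `D` values. -/
theorem card_filter_card_image_le {ι β : Type*} [Fintype ι] [DecidableEq ι] [Fintype β]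
    [DecidableEq β]
    (c D : ℕ) (h : c + D = Fintype.card ι) :
    (univ.filter fun F : ι → β => (univ.image F).card ≤ D).card ≤
      Fintype.card ι ^ (2 * c) * Fintype.card β ^ D := by
  classical
  let T : (Fin c ↪ ι) × (Fin c → ι) → Finset (ι → β) := fun p =>
    univ.filter fun F => ∀ i, p.2 i ∉ Set.range p.1 ∧ F (p.1 i) = F (p.2 i)
  have hT : ∀ p, (T p).card ≤ Fintype.card β ^ D := by
    intro p
    let A : Set ι := (Set.range p.1)ᶜ
    have hA : Fintype.card A = D := by
      rw [Fintype.card_compl_set, Set.card_range_of_injective p.1.injective, Fintype.card_fin]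
      omega
    calc (T p).card ≤ (univ : Finset (A → β)).card := by
          refine card_le_card_of_injOn (fun F a => F a) (by simp) fun F hF G hG e => ?_
          simp only [T, coe_filter, mem_univ, true_and, Set.mem_ofPred_eq] at hF hG
          have e' : ∀ i, i ∉ Set.range p.1 → F i = G i := fun i hi => congrFun e ⟨i, hi⟩
          ext i
          by_cases hi : i ∈ Set.range p.1
          · obtain ⟨j, rfl⟩ := hi
            rw [(hF j).2, (hG j).2, e' _ (hF j).1]
          · exact e' i hi
      _ = Fintype.card β ^ D := by simp [hA]
  have hsub : (univ.filter fun F : ι → β => (univ.image F).card ≤ D) ⊆ univ.biUnion T := by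
    intro F hF
    obtain ⟨-, hF⟩ := mem_filter.1 hF
    have hr : ∀ b ∈ univ.image F, ∃ i, F i = b := by simp
    let r : ι → ι := fun i => (hr (F i) (by simp)).choose
    have hrF : ∀ i, F (r i) = F i := fun i => (hr (F i) (by simp)).choose_spec
    have hrr : ∀ i j, F i = F j → r i = r j := fun i j e => by simp only [r, e]
    have hcard : (univ.image r).card ≤ D := by
      refine le_trans ?_ hF
      refine card_le_card_of_injOn F (by simp) ?_
      rintro i hi j hj e
      simp only [coe_image, coe_univ, Set.image_univ, Set.mem_range] at hi hj
      obtain ⟨i, rfl⟩ := hi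
      obtain ⟨j, rfl⟩ := hj
      exact hrr i j (by rwa [hrF, hrF] at e)
    have hc : c ≤ (univ.image r)ᶜ.card := by
      rw [card_compl]
      omega
    obtain ⟨B, hB, hBc⟩ := exists_subset_card_eq hc
    let a : Fin c ↪ ι := (B.equivFinOfCardEq hBc).symm.toEmbedding.trans (.subtype _)
    have ha : ∀ i, a i ∈ B := fun i => ((B.equivFinOfCardEq hBc).symm i).2
    refine mem_biUnion.2 ⟨(a, fun i => r (a i)), mem_univ _, mem_filter.2 ⟨mem_univ _, ?_⟩⟩
    refine fun i => ⟨?_, (hrF _).symm⟩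
    rintro ⟨j, hj⟩
    have := hB (ha j)
    simp [hj] at this
  calc _ ≤ (univ.biUnion T).card := card_le_card hsub
    _ ≤ Fintype.card ((Fin c ↪ ι) × (Fin c → ι)) * Fintype.card β ^ D :=
        card_biUnion_le_card_mul _ _ _ fun p _ => hT p
    _ ≤ _ := by
        gcongr
        rw [Fintype.card_prod, two_mul, pow_add, Fintype.card_embedding_eq, Fintype.card_fun,
          Fintype.card_fin]
        gcongr
        exact Nat.descFactorial_le_pow _ _

open scoped Matrix.Norms.L2Operator in
theorem opNorm_eq_norm {α β : Type*} [Fintype α] [Fintype β] [DecidableEq β]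
    (M : Matrix α β ℝ) : opNorm M = ‖M‖ := rfl

theorem opNorm_nonneg {α β : Type*} [Fintype α] [Fintype β] [DecidableEq β]
    (M : Matrix α β ℝ) : 0 ≤ opNorm M := norm_nonneg _

open scoped Matrix.Norms.L2Operator in
theorem opNorm_sum_le {α β ι : Type*} [Fintype α] [Fintype β] [DecidableEq β]
    (s : Finset ι) (M : ι → Matrix α β ℝ) : opNorm (∑ i ∈ s, M i) ≤ ∑ i ∈ s, opNorm (M i) :=
  norm_sum_le s M

open scoped Matrix.Norms.L2Operator in
theorem opNorm_smul {α β : Type*} [Fintype α] [Fintype β] [DecidableEq β]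
    (c : ℝ) (M : Matrix α β ℝ) : opNorm (c • M) = |c| * opNorm M :=
  norm_smul c M

theorem opNorm_sq_le_sum_sq {α β : Type*} [Fintype α] [Fintype β] [DecidableEq β]
    (M : Matrix α β ℝ) : opNorm M ^ 2 ≤ ∑ a, ∑ b, M a b ^ 2 := by
  have h0 : 0 ≤ ∑ a, ∑ b, M a b ^ 2 := by positivity
  refine (Real.le_sqrt (opNorm_nonneg M) h0).1 ?_
  refine ContinuousLinearMap.opNorm_le_bound _ (Real.sqrt_nonneg _) fun v => ?_
  rw [EuclideanSpace.norm_eq, EuclideanSpace.norm_eq, ← Real.sqrt_mul h0]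
  refine Real.sqrt_le_sqrt ?_
  rw [sum_mul]
  refine sum_le_sum fun a _ => ?_
  simp only [Real.norm_eq_abs, sq_abs, LinearMap.coe_toContinuousLinearMap',
    Matrix.toLpLin_apply, Matrix.mulVec, dotProduct]
  exact sum_mul_sq_le_sq_mul_sq _ _ _

theorem IsSelfAdjoint.norm_pow_le_norm_pow {E : Type*} [NormedRing E] [StarRing E] [CStarRing E]
    {a : E} (ha : IsSelfAdjoint a) (k : ℕ) (hk : k ≠ 0) : ‖a‖ ^ k ≤ ‖a ^ k‖ := by
  by_cases h0 : ‖a‖ = 0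
  · simp [h0, hk]
  have hpos : 0 < ‖a‖ := lt_of_le_of_ne (norm_nonneg a) (Ne.symm h0)
  have hlt : k < 2 ^ k := Nat.lt_two_pow_self
  have h1 : ‖a‖ ^ 2 ^ k = ‖a ^ k * a ^ (2 ^ k - k)‖ := by
    rw [← pow_add, Nat.add_sub_cancel' hlt.le, ha.norm_pow_two_pow]
  have h2 : ‖a‖ ^ k * ‖a‖ ^ (2 ^ k - k) ≤ ‖a ^ k‖ * ‖a‖ ^ (2 ^ k - k) := by
    rw [← pow_add, Nat.add_sub_cancel' hlt.le, h1]
    refine (norm_mul_le _ _).trans ?_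
    gcongr
    exact norm_pow_le' a (by omega)
  exact le_of_mul_le_mul_right h2 (by positivity)

open Matrix in
theorem opNorm_mul_transpose_self {α β : Type*} [Fintype α] [Fintype β] [DecidableEq α]
    [DecidableEq β] (M : Matrix α β ℝ) : opNorm (M * Mᵀ) = opNorm M ^ 2 := by
  have h := l2_opNorm_conjTranspose_mul_self Mᴴ
  rw [conjTranspose_conjTranspose, l2_opNorm_conjTranspose, conjTranspose_eq_transpose_of_trivial]
    at h
  rw [opNorm_eq_norm, opNorm_eq_norm, h, sq]

open Matrix in
open scoped Matrix.Norms.L2Operator in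
theorem opNorm_pow_le_opNorm_pow_of_isSymm {α : Type*} [Fintype α] [DecidableEq α]
    {A : Matrix α α ℝ} (hA : A.IsSymm) (k : ℕ) (hk : k ≠ 0) : opNorm A ^ k ≤ opNorm (A ^ k) :=
  IsSelfAdjoint.norm_pow_le_norm_pow (E := Matrix α α ℝ)
    (by rw [IsSelfAdjoint, star_eq_conjTranspose, conjTranspose_eq_transpose_of_trivial, hA]) k hk

open Matrix in
theorem opNorm_mul_transpose_self_le_trace {α β : Type*} [Fintype α] [Fintype β] [DecidableEq α]
    [DecidableEq β] (M : Matrix α β ℝ) : opNorm (M * Mᵀ) ≤ trace (M * Mᵀ) := by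
  rw [opNorm_mul_transpose_self]
  refine (opNorm_sq_le_sum_sq M).trans_eq ?_
  simp [trace, mul_apply, sq]

open Matrix in
theorem opNorm_pow_le_trace {α β : Type*} [Fintype α] [Fintype β] [DecidableEq α]
    [DecidableEq β] (M : Matrix α β ℝ) (k : ℕ) (hk : k ≠ 0) :
    opNorm M ^ (2 * k) ≤ trace ((M * Mᵀ) ^ k) := by
  have hA : (M * Mᵀ).IsSymm := by
    rw [IsSymm, transpose_mul, transpose_transpose]
  rw [pow_mul, ← opNorm_mul_transpose_self]
  refine (opNorm_pow_le_opNorm_pow_of_isSymm hA k hk).trans ?_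
  obtain ⟨j, rfl | rfl⟩ := Nat.even_or_odd' k
  · have h : (M * Mᵀ) ^ (2 * j) = (M * Mᵀ) ^ j * ((M * Mᵀ) ^ j)ᵀ := by
      rw [transpose_pow, hA, two_mul, pow_add]
    rw [h]
    exact opNorm_mul_transpose_self_le_trace _
  · have h : (M * Mᵀ) ^ (2 * j + 1) = ((M * Mᵀ) ^ j * M) * ((M * Mᵀ) ^ j * M)ᵀ := by
      rw [transpose_mul, transpose_pow, hA, two_mul, add_right_comm, pow_add, pow_succ]
      simp only [Matrix.mul_assoc]
    rw [h]
    exact opNorm_mul_transpose_self_le_trace _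

theorem Matrix.pow_succ_apply_eq_sum {α R : Type*} [Fintype α] [DecidableEq α] [CommSemiring R]
    (A : Matrix α α R) (k : ℕ) (a b : α) :
    (A ^ (k + 1)) a b = ∑ p : Fin k → α,
      ∏ j : Fin (k + 1), A (Fin.cons (α := fun _ => α) a p j) (Fin.snoc (α := fun _ => α) p b j) := by
  induction k generalizing a with
  | zero => simp [Fin.snoc]
  | succ k ih =>
    rw [pow_succ', mul_apply, ← (Fin.consEquiv fun _ : Fin (k + 1) => α).sum_comp,
      Fintype.sum_prod_type]
    refine sum_congr rfl fun c _ => ?_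
    rw [ih, mul_sum]
    refine sum_congr rfl fun p _ => ?_
    conv_rhs => rw [Fin.prod_univ_succ]
    simp [Fin.consEquiv, ← Fin.cons_snoc_eq_snoc_cons]

theorem Matrix.trace_pow_succ_eq_sum {α R : Type*} [Fintype α] [DecidableEq α] [CommSemiring R]
    (A : Matrix α α R) (k : ℕ) :
    trace (A ^ (k + 1)) = ∑ p : Fin (k + 1) → α, ∏ j, A (p j) (p (j + 1)) := by
  rw [← (Fin.consEquiv fun _ : Fin (k + 1) => α).sum_comp, Fintype.sum_prod_type]
  simp only [trace, diag_apply, pow_succ_apply_eq_sum]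
  refine sum_congr rfl fun a _ => sum_congr rfl fun p _ => prod_congr rfl fun j _ => ?_
  congr 1
  induction j using Fin.lastCases with
  | last => simp [Fin.consEquiv]
  | cast j => simp [Fin.consEquiv]

theorem Matrix.trace_mul_transpose_pow_succ {α β R : Type*} [Fintype α] [DecidableEq α]
    [Fintype β] [CommSemiring R] (M : Matrix α β R) (k : ℕ) :
    trace ((M * M.transpose) ^ (k + 1)) =
      ∑ A : Fin (k + 1) → α, ∑ B : Fin (k + 1) → β,
        ∏ s : Fin (k + 1) × Bool, M (A (if s.2 then s.1 + 1 else s.1)) (B s.1) := by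
  classical
  rw [trace_pow_succ_eq_sum]
  refine sum_congr rfl fun A _ => ?_
  simp only [mul_apply, transpose_apply]
  rw [Fintype.prod_sum]
  refine sum_congr rfl fun B _ => ?_
  rw [Fintype.prod_prod_type]
  simp [mul_comm]

/-- The map sending `U`, `V`, `W` to `A`, `B`, `C` respectively. -/
def placement {n x y z : ℕ} (A : SubsetsCard n x) (B : SubsetsCard n y) (C : Fin z → Fin n) :
    Fin x ⊕ Fin y ⊕ Fin z → Fin n :=
  Sum.elim (tup A) (Sum.elim (tup B) C)

theorem tup_injective {n x : ℕ} (A : SubsetsCard n x) : Function.Injective (tup A) :=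
  Subtype.val_injective.comp (A.1.orderIsoOfFin A.2).injective

theorem range_tup {n x : ℕ} (A : SubsetsCard n x) : Set.range (tup A) = A.1 := by
  ext a
  constructor
  · rintro ⟨i, rfl⟩
    exact (A.1.orderIsoOfFin A.2 i).2
  · intro ha
    exact ⟨(A.1.orderIsoOfFin A.2).symm ⟨a, ha⟩, by simp [tup]⟩

theorem eq_of_tup_eq {n x : ℕ} {A A' : SubsetsCard n x} (h : tup A = tup A') : A = A' := by
  refine Subtype.ext (Finset.coe_injective ?_)
  rw [← range_tup, h, range_tup]

theorem mem_iff_exists_tup {n x : ℕ} (A : SubsetsCard n x) (a : Fin n) :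
    a ∈ A.1 ↔ ∃ i, tup A i = a := by
  rw [← Set.mem_range, range_tup, mem_coe]

theorem placement_injective_iff {n x y z : ℕ} (A : SubsetsCard n x) (B : SubsetsCard n y)
    (C : Fin z → Fin n) :
    Function.Injective (placement A B C) ↔
      Disjoint A.1 B.1 ∧ Function.Injective C ∧ ∀ m, C m ∉ A.1 ∧ C m ∉ B.1 := by
  simp only [disjoint_left, mem_iff_exists_tup, not_exists]
  constructor
  · intro h
    refine ⟨?_, fun i j e => ?_, fun m => ⟨fun i e => ?_, fun i e => ?_⟩⟩
    · rintro _ ⟨i, rfl⟩ j e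
      exact Sum.inr_ne_inl (@h (.inr (.inl j)) (.inl i) e)
    · simpa using @h (.inr (.inr i)) (.inr (.inr j)) e
    · simpa using @h (.inl i) (.inr (.inr m)) e
    · simpa using @h (.inr (.inl i)) (.inr (.inr m)) e
  · rintro ⟨hAB, hC, hCAB⟩
    refine (tup_injective A).sumElim ((tup_injective B).sumElim hC ?_) ?_
    · exact fun j m e => (hCAB m).2 j e
    · rintro i (j | m) e
      · exact hAB ⟨i, rfl⟩ j e.symm
      · exact (hCAB m).1 i e

theorem RHgen_apply {n x y z : ℕ} (H : SimpleGraph (Fin x ⊕ Fin y ⊕ Fin z))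
    [DecidableRel H.Adj] (g : Sym2 (Fin n) → Bool) (A : SubsetsCard n x) (B : SubsetsCard n y) :
    RHgen H g A B = ∑ C : Fin z → Fin n,
      if Function.Injective (placement A B C) then
        ∏ e ∈ H.edgeFinset, sgn (g (Sym2.map (placement A B C) e)) else 0 := by
  classical
  simp only [placement_injective_iff, RHgen, Matrix.of_apply]
  by_cases hAB : Disjoint A.1 B.1
  · simp only [hAB, true_and, if_true, ite_and]
    rw [← sum_filter (fun C : Fin z → Fin n => Function.Injective C)]
    refine sum_bij (fun C _ => ⇑C) (by simp [Function.Embedding.injective])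
      (fun C _ C' _ h => DFunLike.coe_injective h) (fun C hC => ?_) (fun C _ => rfl)
    exact ⟨⟨C, (mem_filter.1 hC).2⟩, mem_univ _, rfl⟩
  · simp [hAB]

/-- The part of `RHgen` coming from placements sending every vertex to an element of its own
color. -/
noncomputable def coloredRHgen {n x y z : ℕ} (H : SimpleGraph (Fin x ⊕ Fin y ⊕ Fin z))
    [DecidableRel H.Adj] (σ : Fin n → Fin x ⊕ Fin y ⊕ Fin z) (g : Sym2 (Fin n) → Bool) :
    Matrix (SubsetsCard n x) (SubsetsCard n y) ℝ :=
  Matrix.of fun A B => ∑ C : Fin z → Fin n,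
    if ∀ v, σ (placement A B C v) = v then
      ∏ e ∈ H.edgeFinset, sgn (g (Sym2.map (placement A B C) e)) else 0

theorem card_leftInverse_mul_pow {α V : Type*} [Fintype α] [DecidableEq α] [Fintype V]
    [DecidableEq V] (φ : V → α) (hφ : Function.Injective φ) :
    (univ.filter fun σ : α → V => ∀ v, σ (φ v) = v).card * Fintype.card V ^ Fintype.card V =
      Fintype.card V ^ Fintype.card α := by
  have h : (univ.filter fun σ : α → V => ∀ v, σ (φ v) = v) =
      Fintype.piFinset fun a => univ.filter fun w => ∀ v, φ v = a → w = v := by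
    ext σ
    simp only [mem_filter, mem_univ, true_and, Fintype.mem_piFinset]
    exact ⟨fun h a v e => by rw [← e, h], fun h v => h _ v rfl⟩
  have hc : ∀ a, (univ.filter fun w => ∀ v, φ v = a → w = v).card =
      if a ∈ univ.image φ then 1 else Fintype.card V := by
    intro a
    split_ifs with ha
    · obtain ⟨v, -, rfl⟩ := mem_image.1 ha
      rw [card_eq_one]
      refine ⟨v, ?_⟩
      ext w
      simp [hφ.eq_iff]
    · have : ∀ v, φ v ≠ a := fun v e => ha (by simp [← e])
      simp [this]
  rw [h, Fintype.card_piFinset, prod_congr rfl fun a _ => hc a, prod_ite, prod_const_one, one_mul,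
    prod_const, ← pow_add]
  congr 1
  have h1 := card_filter_add_card_filter_not (s := (univ : Finset α)) (fun a => a ∈ univ.image φ)
  have h2 : (univ.filter fun a => a ∈ univ.image φ).card = Fintype.card V := by
    rw [filter_mem_eq_inter, univ_inter, card_image_of_injective _ hφ, card_univ]
  rw [card_univ] at h1
  omega

theorem smul_RHgen_eq {n x y z : ℕ} (H : SimpleGraph (Fin x ⊕ Fin y ⊕ Fin z))
    [DecidableRel H.Adj] (g : Sym2 (Fin n) → Bool) :
    (((x + y + z : ℕ) : ℝ) ^ n) • RHgen H g =
      (((x + y + z : ℕ) : ℝ) ^ (x + y + z)) • ∑ σ, coloredRHgen H σ g := by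
  classical
  have ht : Fintype.card (Fin x ⊕ Fin y ⊕ Fin z) = x + y + z := by simp [add_assoc]
  ext A B
  simp only [Matrix.smul_apply, Matrix.sum_apply, coloredRHgen, Matrix.of_apply, RHgen_apply,
    smul_eq_mul]
  rw [sum_comm, mul_sum, mul_sum]
  refine sum_congr rfl fun C _ => ?_
  rw [← sum_filter, sum_const, nsmul_eq_mul, ← mul_assoc]
  split_ifs with h
  · have := card_leftInverse_mul_pow _ h
    rw [ht, Fintype.card_fin] at this
    have h' := congrArg (Nat.cast (R := ℝ)) this
    rw [Nat.cast_mul, Nat.cast_pow, Nat.cast_pow] at h'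
    rw [← h', mul_comm (Nat.cast _)]
  · rw [filter_eq_empty_iff.2]
    · simp
    · intro σ _ hσ
      exact h (Function.LeftInverse.injective hσ)

theorem opNorm_RHgen_pow_le {n x y z : ℕ} (H : SimpleGraph (Fin x ⊕ Fin y ⊕ Fin z))
    [DecidableRel H.Adj] (g : Sym2 (Fin n) → Bool) (ht : 1 ≤ x + y + z) (m : ℕ) :
    ((x + y + z : ℕ) : ℝ) ^ n * opNorm (RHgen H g) ^ (m + 1) ≤
      (((x + y + z : ℕ) : ℝ) ^ (x + y + z)) ^ (m + 1) *
        ∑ σ, opNorm (coloredRHgen H σ g) ^ (m + 1) := by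
  have hc : Fintype.card (Fin x ⊕ Fin y ⊕ Fin z) = x + y + z := by simp [add_assoc]
  set t : ℝ := ((x + y + z : ℕ) : ℝ) with htdef
  have ht0 : 0 < t := by rw [htdef]; exact_mod_cast ht
  have h1 : t ^ n * opNorm (RHgen H g) ≤ t ^ (x + y + z) * ∑ σ, opNorm (coloredRHgen H σ g) := by
    have := congrArg opNorm (smul_RHgen_eq H g)
    rw [opNorm_smul, opNorm_smul, ← htdef, abs_of_pos (by positivity), abs_of_pos (by positivity)]
      at this
    rw [this]
    gcongr
    exact opNorm_sum_le _ _
  have h2 := pow_sum_div_card_le_sum_pow (s := univ) (f := fun σ => opNorm (coloredRHgen H σ g))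
    (fun σ _ => opNorm_nonneg _) m
  rw [card_univ, Fintype.card_fun, hc, Fintype.card_fin, Nat.cast_pow, ← htdef,
    div_le_iff₀ (by positivity)] at h2
  have h3 := pow_le_pow_left₀ (mul_nonneg (by positivity) (opNorm_nonneg _)) h1 (m + 1)
  rw [mul_pow, mul_pow] at h3
  have h4 : (t ^ n) ^ m * (t ^ n * opNorm (RHgen H g) ^ (m + 1)) ≤
      (t ^ n) ^ m * ((t ^ (x + y + z)) ^ (m + 1) *
        ∑ σ, opNorm (coloredRHgen H σ g) ^ (m + 1)) := by
    calc _ = (t ^ n) ^ (m + 1) * opNorm (RHgen H g) ^ (m + 1) := by ring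
      _ ≤ _ := h3
      _ ≤ _ := mul_le_mul_of_nonneg_left h2 (by positivity)
      _ = _ := by ring
  exact le_of_mul_le_mul_left h4 (by positivity)

theorem abs_sgn (b : Bool) : |sgn b| = 1 := by cases b <;> simp [sgn]

theorem sgn_not (b : Bool) : sgn (!b) = -sgn b := by cases b <;> simp [sgn]

theorem sum_prod_sgn_eq_zero {P E : Type*} [Fintype E] [DecidableEq E] (s : Finset P)
    (e : P → E) {p : P} (hp : p ∈ s) (h : ∀ p' ∈ s, p' ≠ p → e p' ≠ e p) :
    ∑ g : E → Bool, ∏ p' ∈ s, sgn (g (e p')) = 0 := by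
  classical
  let flip : (E → Bool) → E → Bool := fun g => Function.update g (e p) (!g (e p))
  have hflip : Function.Involutive flip := fun g => by simp [flip]
  have hsum := hflip.bijective.sum_comp (g := fun g : E → Bool => ∏ p' ∈ s, sgn (g (e p')))
  have hneg : ∀ g, ∏ p' ∈ s, sgn (flip g (e p')) = -∏ p' ∈ s, sgn (g (e p')) := by
    intro g
    rw [← mul_prod_erase s _ hp, ← mul_prod_erase s (fun p' => sgn (g (e p'))) hp]
    simp only [flip, Function.update_self, sgn_not, neg_mul]
    congr 2
    refine prod_congr rfl fun p' hp' => ?_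
    rw [Function.update_of_ne (h p' (mem_of_mem_erase hp') (ne_of_mem_erase hp'))]
  simp only [hneg, sum_neg_distrib] at hsum
  linarith

theorem sum_prod_sgn_le {P E : Type*} [Fintype E] [DecidableEq E] (s : Finset P) (e : P → E) :
    ∑ g : E → Bool, ∏ p ∈ s, sgn (g (e p)) ≤ Fintype.card (E → Bool) := by
  rw [← card_univ, card_eq_sum_ones, Nat.cast_sum]
  refine sum_le_sum fun g _ => (le_abs_self _).trans ?_
  simp [abs_prod, abs_sgn]

/-- The vertices of the closed chain of `2 * k` copies of `H`: `k` copies of each vertex of `U` and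
`V`, and `2 * k` copies of each remaining vertex. -/
abbrev ChainIndex (k x y z : ℕ) :=
  (Fin k × Fin x) ⊕ (Fin k × Fin y) ⊕ ((Fin k × Bool) × Fin z)

/-- The inclusion of the copy `s` of `H` into the closed chain. -/
def chainInclusion {k x y z : ℕ} (s : Fin (k + 1) × Bool) :
    Fin x ⊕ Fin y ⊕ Fin z → ChainIndex (k + 1) x y z :=
  Sum.map (fun i => (if s.2 then s.1 + 1 else s.1, i))
    (Sum.map (fun i => (s.1, i)) fun i => (s, i))

/-- The placement of the closed chain given by the placements of its parts. -/
def chainPlacement {n k x y z : ℕ} (A : Fin k → SubsetsCard n x) (B : Fin k → SubsetsCard n y)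
    (C : Fin k × Bool → Fin z → Fin n) : ChainIndex k x y z → Fin n :=
  Sum.elim (fun p => tup (A p.1) p.2) (Sum.elim (fun p => tup (B p.1) p.2) fun p => C p.1 p.2)

theorem chainPlacement_comp_chainInclusion {n k x y z : ℕ} (A : Fin (k + 1) → SubsetsCard n x)
    (B : Fin (k + 1) → SubsetsCard n y) (C : Fin (k + 1) × Bool → Fin z → Fin n)
    (s : Fin (k + 1) × Bool) :
    chainPlacement A B C ∘ chainInclusion s =
      placement (A (if s.2 then s.1 + 1 else s.1)) (B s.1) (C s) := by
  ext (i | j | m) <;> rfl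

theorem chainPlacement_injective {n k x y z : ℕ} :
    Function.Injective fun p : (Fin k → SubsetsCard n x) × (Fin k → SubsetsCard n y) ×
      (Fin k × Bool → Fin z → Fin n) => chainPlacement p.1 p.2.1 p.2.2 := by
  rintro ⟨A, B, C⟩ ⟨A', B', C'⟩ h
  refine Prod.ext ?_ (Prod.ext ?_ ?_)
  · exact funext fun j => eq_of_tup_eq (funext fun i => congrFun h (.inl (j, i)))
  · exact funext fun j => eq_of_tup_eq (funext fun i => congrFun h (.inr (.inl (j, i))))
  · exact funext fun s => funext fun i => congrFun h (.inr (.inr (s, i)))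

/-- The contribution of the placement `F` of the closed chain to the trace of the
`k + 1`-st power of `coloredRHgen * coloredRHgenᵀ`. -/
noncomputable def chainWeight {n k x y z : ℕ} (H : SimpleGraph (Fin x ⊕ Fin y ⊕ Fin z))
    [DecidableRel H.Adj] (σ : Fin n → Fin x ⊕ Fin y ⊕ Fin z)
    (F : ChainIndex (k + 1) x y z → Fin n) (g : Sym2 (Fin n) → Bool) : ℝ :=
  if ∀ s v, σ (F (chainInclusion s v)) = v then
    ∏ p ∈ univ ×ˢ H.edgeFinset, sgn (g (Sym2.map (F ∘ chainInclusion p.1) p.2)) else 0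

theorem trace_coloredRHgen_pow {n x y z : ℕ} (H : SimpleGraph (Fin x ⊕ Fin y ⊕ Fin z))
    [DecidableRel H.Adj] (σ : Fin n → Fin x ⊕ Fin y ⊕ Fin z) (g : Sym2 (Fin n) → Bool) (k : ℕ) :
    Matrix.trace ((coloredRHgen H σ g * (coloredRHgen H σ g).transpose) ^ (k + 1)) =
      ∑ p : (Fin (k + 1) → SubsetsCard n x) × (Fin (k + 1) → SubsetsCard n y) ×
        (Fin (k + 1) × Bool → Fin z → Fin n),
        chainWeight H σ (chainPlacement p.1 p.2.1 p.2.2) g := by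
  classical
  rw [Matrix.trace_mul_transpose_pow_succ, Fintype.sum_prod_type]
  refine sum_congr rfl fun A _ => ?_
  rw [Fintype.sum_prod_type]
  refine sum_congr rfl fun B _ => ?_
  simp only [coloredRHgen, Matrix.of_apply]
  rw [Fintype.prod_sum]
  refine sum_congr rfl fun C _ => ?_
  rw [prod_ite_zero, chainWeight, prod_product]
  simp only [← chainPlacement_comp_chainInclusion, Function.comp_apply, mem_univ, true_implies]

theorem card_image_le_of_sum_chainWeight_ne_zero {n k x y z q : ℕ}
    (H : SimpleGraph (Fin x ⊕ Fin y ⊕ Fin z)) [DecidableRel H.Adj]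
    (hdeg : ∀ m : Fin z, 0 < H.degree (Sum.inr (Sum.inr m)))
    (hsep : ∀ S, IsSep H S → q ≤ S.card) (σ : Fin n → Fin x ⊕ Fin y ⊕ Fin z)
    (F : ChainIndex (k + 1) x y z → Fin n) (hF : ∑ g, chainWeight H σ F g ≠ 0) :
    (univ.image F).card + q * k ≤ (k + 1) * (x + y + z) := by
  classical
  have hσ : ∀ s v, σ (F (chainInclusion s v)) = v := by
    by_contra h
    exact hF (sum_eq_zero fun g _ => if_neg h)
  have hedge : ∀ a b, H.Adj a b → ∀ s, ∃ s', s' ≠ s ∧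
      F (chainInclusion s' a) = F (chainInclusion s a) ∧
      F (chainInclusion s' b) = F (chainInclusion s b) := by
    intro a b hab s
    by_contra! hcon
    refine hF ?_
    simp only [chainWeight, hσ, implies_true, if_true]
    refine sum_prod_sgn_eq_zero (univ ×ˢ H.edgeFinset)
      (fun p => Sym2.map (F ∘ chainInclusion p.1) p.2) (p := (s, s(a, b))) (by simpa using hab) ?_
    rintro ⟨s', e⟩ - hne heq
    have hinv : ∀ r e, Sym2.map σ (Sym2.map (F ∘ chainInclusion r) e) = e := by
      intro r e
      rw [Sym2.map_map, show σ ∘ F ∘ chainInclusion r = id from funext (hσ r), Sym2.map_id, id]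
    have he : e = s(a, b) := by
      rw [← hinv s' e]
      dsimp only at heq
      rw [heq, hinv]
    subst he
    have hs : s' ≠ s := fun h => hne (by rw [h])
    simp only [Sym2.map_mk, Sym2.eq_iff, Function.comp_apply] at heq
    rcases heq with ⟨h1, h2⟩ | ⟨h1, -⟩
    · exact hcon s' hs h1 h2
    · have := congrArg σ h1
      rw [hσ, hσ] at this
      exact hab.ne this
  have hcardS : Fintype.card (Fin (k + 1) × Bool) = 2 * (k + 1) := by simp [mul_comm]
  have hk : ∀ v, (univ.image fun s => F (chainInclusion s v)).card ≤ k + 1 := by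
    rintro (i | j | m)
    · calc _ ≤ (univ.image fun j : Fin (k + 1) => F (.inl (j, i))).card := by
            refine card_le_card ?_
            intro b hb
            obtain ⟨s, -, rfl⟩ := mem_image.1 hb
            exact mem_image.2 ⟨_, mem_univ _, rfl⟩
        _ ≤ k + 1 := card_image_le.trans (by simp)
    · calc _ ≤ (univ.image fun l : Fin (k + 1) => F (.inr (.inl (l, j)))).card := by
            refine card_le_card ?_
            intro b hb
            obtain ⟨s, -, rfl⟩ := mem_image.1 hb
            exact mem_image.2 ⟨_, mem_univ _, rfl⟩
        _ ≤ k + 1 := card_image_le.trans (by simp)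
    · obtain ⟨b, hb⟩ := (H.degree_pos_iff_exists_adj _).1 (hdeg m)
      have := two_mul_card_image_le (fun s => F (chainInclusion s (.inr (.inr m)))) fun s => by
        obtain ⟨s', h, h', -⟩ := hedge _ b hb s
        exact ⟨s', h, h'⟩
      omega
  have hmain := sum_card_image_add_mul_le (H := H)
    (I := fun v => ∃ i, v = .inl i) (O := fun v => ∃ j, v = .inr (.inl j))
    (fun s v => F (chainInclusion s v)) (k + 1) q hcardS hk hedge ?_ ?_
  · have himg : univ.image F ⊆ univ.biUnion fun v => univ.image fun s => F (chainInclusion s v) := by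
      intro b hb
      obtain ⟨i, -, rfl⟩ := mem_image.1 hb
      rcases i with ⟨j, i⟩ | ⟨j, i⟩ | ⟨s, m⟩
      · exact mem_biUnion.2 ⟨.inl i, mem_univ _, mem_image.2 ⟨(j, false), mem_univ _, rfl⟩⟩
      · exact mem_biUnion.2 ⟨.inr (.inl i), mem_univ _, mem_image.2 ⟨(j, false), mem_univ _, rfl⟩⟩
      · exact mem_biUnion.2 ⟨.inr (.inr m), mem_univ _, mem_image.2 ⟨s, mem_univ _, rfl⟩⟩
    have h1 := (card_le_card himg).trans card_biUnion_le
    simp only [Fintype.card_sum, Fintype.card_fin, ← add_assoc, Nat.add_sub_cancel] at hmain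
    omega
  · rintro _ _ ⟨i, rfl⟩ ⟨j, rfl⟩ h hu hv
    have hpair : ∀ l, h (l, true) = h (l, false) := fun l => hv _ _ rfl
    have hstep : ∀ l, h (l + 1, false) = h (l, true) := fun l => hu _ _ rfl
    have hconst : ∀ l, h (l, false) = h (0, false) := by
      intro l
      induction l using Fin.induction with
      | zero => rfl
      | succ l ih => rw [← Fin.coeSucc_eq_succ, hstep, hpair, ih]
    have hall : ∀ s, h s = h (0, false) := by
      rintro ⟨l, _ | _⟩
      · exact hconst l
      · rw [hpair, hconst]
    intro s s'
    rw [hall s, hall s']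
  · intro T hT
    exact hsep T fun i j p => hT _ _ ⟨i, rfl⟩ ⟨j, rfl⟩ p

theorem sum_chainWeight_le {n k x y z : ℕ} (H : SimpleGraph (Fin x ⊕ Fin y ⊕ Fin z))
    [DecidableRel H.Adj] (σ : Fin n → Fin x ⊕ Fin y ⊕ Fin z)
    (F : ChainIndex (k + 1) x y z → Fin n) :
    ∑ g, chainWeight H σ F g ≤ Fintype.card (Sym2 (Fin n) → Bool) := by
  unfold chainWeight
  split_ifs
  · exact sum_prod_sgn_le _ _
  · simp

theorem sum_trace_coloredRHgen_le {n x y z q r : ℕ}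
    (H : SimpleGraph (Fin x ⊕ Fin y ⊕ Fin z)) [DecidableRel H.Adj]
    (hdeg : ∀ m : Fin z, 0 < H.degree (Sum.inr (Sum.inr m)))
    (hsep : ∀ S, IsSep H S → q ≤ S.card) (hr : x + y + z = q + r)
    (σ : Fin n → Fin x ⊕ Fin y ⊕ Fin z) (k : ℕ) :
    ∑ g, Matrix.trace ((coloredRHgen H σ g * (coloredRHgen H σ g).transpose) ^ (k + 1)) ≤
      Fintype.card (Sym2 (Fin n) → Bool) *
        ((((k + 1) * (x + y + 2 * z)) ^ (2 * ((k + 1) * z + q * k)) *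
          n ^ ((k + 1) * r + q) : ℕ) : ℝ) := by
  classical
  set D := (k + 1) * r + q
  set c := (k + 1) * z + q * k
  have hN : Fintype.card (ChainIndex (k + 1) x y z) = (k + 1) * (x + y + 2 * z) := by
    simp
    ring
  have hcD : c + D = Fintype.card (ChainIndex (k + 1) x y z) := by
    rw [hN]
    calc c + D = (k + 1) * (q + r) + (k + 1) * z := by simp only [c, D]; ring
      _ = _ := by rw [← hr]; ring
  simp only [trace_coloredRHgen_pow]
  rw [sum_comm]
  set w : (ChainIndex (k + 1) x y z → Fin n) → ℝ := fun F =>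
    if (univ.image F).card ≤ D then (Fintype.card (Sym2 (Fin n) → Bool) : ℝ) else 0 with hw
  have hw0 : ∀ F, 0 ≤ w F := fun F => by
    simp only [hw]
    split_ifs <;> positivity
  calc _ ≤ ∑ p : (Fin (k + 1) → SubsetsCard n x) × (Fin (k + 1) → SubsetsCard n y) ×
        (Fin (k + 1) × Bool → Fin z → Fin n), w (chainPlacement p.1 p.2.1 p.2.2) := by
        refine sum_le_sum fun p _ => ?_
        by_cases h0 : ∑ g, chainWeight H σ (chainPlacement p.1 p.2.1 p.2.2) g = 0
        · rw [h0]
          exact hw0 _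
        · have := card_image_le_of_sum_chainWeight_ne_zero H hdeg hsep σ _ h0
          rw [hr] at this
          have hD : (univ.image (chainPlacement p.1 p.2.1 p.2.2)).card ≤ D := by
            simp only [D]
            linarith
          simp only [hw, hD, if_true]
          exact sum_chainWeight_le H σ _
    _ = ∑ F ∈ univ.image fun p : (Fin (k + 1) → SubsetsCard n x) ×
        (Fin (k + 1) → SubsetsCard n y) × (Fin (k + 1) × Bool → Fin z → Fin n) =>
          chainPlacement p.1 p.2.1 p.2.2, w F :=
        (sum_image fun p _ p' _ h => chainPlacement_injective h).symm
    _ ≤ ∑ F, w F := sum_le_univ_sum_of_nonneg hw0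
    _ = Fintype.card (Sym2 (Fin n) → Bool) *
          ((univ.filter fun F : ChainIndex (k + 1) x y z → Fin n =>
            (univ.image F).card ≤ D).card : ℝ) := by
        rw [hw, ← sum_filter, sum_const, nsmul_eq_mul, mul_comm]
    _ ≤ _ := by
        gcongr
        have := card_filter_card_image_le (ι := ChainIndex (k + 1) x y z) (β := Fin n) c D hcD
        rwa [hN, Fintype.card_fin] at this

theorem sum_opNorm_RHgen_pow_le {n x y z q r : ℕ}
    (H : SimpleGraph (Fin x ⊕ Fin y ⊕ Fin z)) [DecidableRel H.Adj]
    (hdeg : ∀ m : Fin z, 0 < H.degree (Sum.inr (Sum.inr m)))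
    (hsep : ∀ S, IsSep H S → q ≤ S.card) (hr : x + y + z = q + r) (ht : 1 ≤ x + y + z) (k : ℕ) :
    ∑ g : Sym2 (Fin n) → Bool, opNorm (RHgen H g) ^ (2 * (k + 1)) ≤
      (((x + y + z : ℕ) : ℝ) ^ (x + y + z)) ^ (2 * (k + 1)) *
      (Fintype.card (Sym2 (Fin n) → Bool) *
        ((((k + 1) * (x + y + 2 * z)) ^ (2 * ((k + 1) * z + q * k)) *
          n ^ ((k + 1) * r + q) : ℕ) : ℝ)) := by
  have hc : Fintype.card (Fin x ⊕ Fin y ⊕ Fin z) = x + y + z := by simp [add_assoc]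
  set b : ℝ := Fintype.card (Sym2 (Fin n) → Bool) *
        ((((k + 1) * (x + y + 2 * z)) ^ (2 * ((k + 1) * z + q * k)) *
          n ^ ((k + 1) * r + q) : ℕ) : ℝ)
  set t : ℝ := ((x + y + z : ℕ) : ℝ) with htdef
  have ht0 : 0 < t := by rw [htdef]; exact_mod_cast ht
  have key : t ^ n * ∑ g : Sym2 (Fin n) → Bool, opNorm (RHgen H g) ^ (2 * (k + 1)) ≤
      t ^ n * ((t ^ (x + y + z)) ^ (2 * (k + 1)) * b) := by
    calc _ ≤ ∑ g : Sym2 (Fin n) → Bool, (t ^ (x + y + z)) ^ (2 * (k + 1)) *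
          ∑ σ, opNorm (coloredRHgen H σ g) ^ (2 * (k + 1)) := by
          rw [mul_sum]
          exact sum_le_sum fun g _ => opNorm_RHgen_pow_le H g ht (2 * k + 1)
      _ = (t ^ (x + y + z)) ^ (2 * (k + 1)) *
          ∑ σ, ∑ g, opNorm (coloredRHgen H σ g) ^ (2 * (k + 1)) := by
          rw [← mul_sum, sum_comm]
      _ ≤ (t ^ (x + y + z)) ^ (2 * (k + 1)) *
          ∑ σ : Fin n → Fin x ⊕ Fin y ⊕ Fin z, b := by
          gcongr with σ
          refine le_trans (sum_le_sum fun g _ => ?_)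
            (sum_trace_coloredRHgen_le H hdeg hsep hr σ k)
          exact opNorm_pow_le_trace _ _ (by omega)
      _ = _ := by
          rw [sum_const, card_univ, Fintype.card_fun, hc, Fintype.card_fin, nsmul_eq_mul,
            Nat.cast_pow, ← htdef]
          ring
  exact le_of_mul_le_mul_left key (by positivity)

theorem Pr_le_of_sum_pow_le {n : ℕ} (X : (Sym2 (Fin n) → Bool) → ℝ) {θ ε : ℝ} (hθ : 0 < θ) (p : ℕ)
    (hX : ∀ g, 0 ≤ X g)
    (h : ∑ g, X g ^ p ≤ ε * θ ^ p * Fintype.card (Sym2 (Fin n) → Bool)) :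
    Pr (fun g => θ ≤ X g) ≤ ε := by
  classical
  have hc : (0 : ℝ) < Fintype.card (Sym2 (Fin n) → Bool) := by exact_mod_cast Fintype.card_pos
  have h1 : ((univ.filter fun g => θ ≤ X g).card : ℝ) * θ ^ p ≤ ∑ g, X g ^ p := by
    rw [← nsmul_eq_mul]
    refine (card_nsmul_le_sum _ (fun g => X g ^ p) _ fun g hg => ?_).trans
      (sum_le_univ_sum_of_nonneg fun g => pow_nonneg (hX g) p)
    exact pow_le_pow_left₀ hθ.le (mem_filter.1 hg).2 p
  have h2 : ((univ.filter fun g => θ ≤ X g).card : ℝ) ≤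
      ε * Fintype.card (Sym2 (Fin n) → Bool) := by
    refine le_of_mul_le_mul_right (a := θ ^ p) ?_ (by positivity)
    linarith
  unfold Pr
  rw [div_le_iff₀ hc]
  convert h2

theorem card_subsetsCard_le (n x : ℕ) : Fintype.card (SubsetsCard n x) ≤ n ^ x := by
  rw [Fintype.card_finset_len, Fintype.card_fin]
  exact Nat.choose_le_pow n x

theorem opNorm_RHgen_le_of_eq_zero {n x y z : ℕ} (H : SimpleGraph (Fin x ⊕ Fin y ⊕ Fin z))
    [DecidableRel H.Adj] (hz : z = 0) (g : Sym2 (Fin n) → Bool) :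
    opNorm (RHgen H g) ≤ (n : ℝ) ^ (((x + y + z : ℕ) : ℝ) / 2) := by
  subst hz
  have hentry : ∀ A B, RHgen H g A B ^ 2 ≤ 1 := by
    intro A B
    rw [RHgen_apply, Fintype.sum_unique]
    split_ifs
    · rw [← sq_abs, abs_prod]
      simp [abs_sgn]
    · simp
  have hsq : opNorm (RHgen H g) ^ 2 ≤ (n : ℝ) ^ (x + y) := by
    calc _ ≤ ∑ A, ∑ B, RHgen H g A B ^ 2 := opNorm_sq_le_sum_sq _
      _ ≤ ∑ A : SubsetsCard n x, ∑ B : SubsetsCard n y, (1 : ℝ) :=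
        sum_le_sum fun A _ => sum_le_sum fun B _ => hentry A B
      _ = ((Fintype.card (SubsetsCard n x) * Fintype.card (SubsetsCard n y) : ℕ) : ℝ) := by
        simp
      _ ≤ ((n ^ x * n ^ y : ℕ) : ℝ) := by
        exact_mod_cast Nat.mul_le_mul (card_subsetsCard_le n x) (card_subsetsCard_le n y)
      _ = (n : ℝ) ^ (x + y) := by
        push_cast
        ring
  refine (pow_le_pow_iff_left₀ (opNorm_nonneg _) (by positivity) two_ne_zero).1 (hsq.trans_eq ?_)
  rw [← Real.rpow_natCast, ← Real.rpow_natCast, ← Real.rpow_mul n.cast_nonneg]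
  congr 1
  push_cast
  ring

theorem moment_bound_le_threshold {n t q z r k w : ℕ} {ε L : ℝ} (hn : 1 ≤ n) (hε : 0 < ε)
    (hr : t = q + r) (hw : 1 ≤ w) (hk : (k : ℝ) + 1 ≤ L + 1)
    (hL : Real.log (8 * (n : ℝ) ^ q / ε) ≤ 2 * ((k : ℝ) + 1) * ((q + z : ℕ) : ℝ)) :
    ((t : ℝ) ^ t) ^ (2 * (k + 1)) *
        ((((k + 1) * w) ^ (2 * ((k + 1) * z + q * k)) * n ^ ((k + 1) * r + q) : ℕ) : ℝ) ≤
      ε * (2 * (t : ℝ) ^ t * (Real.exp 1 * (w : ℝ) * (L + 1)) ^ (q + z) *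
        (n : ℝ) ^ (((t : ℝ) - (q : ℝ)) / 2)) ^ (2 * (k + 1)) := by
  have hn0 : (0 : ℝ) < n := by exact_mod_cast hn
  have hw1 : (1 : ℝ) ≤ w := by exact_mod_cast hw
  have hexp : 8 * (n : ℝ) ^ q / ε ≤ Real.exp 1 ^ (2 * (k + 1) * (q + z)) := by
    rw [← Real.exp_nat_mul, mul_one, ← Real.log_le_iff_le_exp (by positivity)]
    push_cast at hL ⊢
    exact hL
  have hexp' : (n : ℝ) ^ q ≤ ε * Real.exp 1 ^ (2 * (k + 1) * (q + z)) := by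
    rw [div_le_iff₀ hε] at hexp
    nlinarith [pow_pos hn0 q]
  have hrpow : ((n : ℝ) ^ (((t : ℝ) - (q : ℝ)) / 2)) ^ (2 * (k + 1)) = (n : ℝ) ^ ((k + 1) * r) := by
    rw [← Real.rpow_natCast, ← Real.rpow_mul hn0.le, ← Real.rpow_natCast]
    congr 1
    rw [hr]
    push_cast
    ring
  have hkw : (1 : ℝ) ≤ ((k : ℝ) + 1) * w := by
    have : (0 : ℝ) ≤ k := k.cast_nonneg
    nlinarith
  calc _ = ((t : ℝ) ^ t) ^ (2 * (k + 1)) * (((((k : ℝ) + 1) * w) ^ (2 * ((k + 1) * z + q * k))) *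
        ((n : ℝ) ^ ((k + 1) * r) * (n : ℝ) ^ q)) := by
        push_cast
        ring
    _ ≤ ((t : ℝ) ^ t) ^ (2 * (k + 1)) * (((((k : ℝ) + 1) * w) ^ (2 * (k + 1) * (q + z))) *
        ((n : ℝ) ^ ((k + 1) * r) * (ε * Real.exp 1 ^ (2 * (k + 1) * (q + z))))) := by
        gcongr ?_ * (?_ * (?_ * ?_))
        refine pow_le_pow_right₀ hkw ?_
        nlinarith
    _ = ε * (1 * (t : ℝ) ^ t * (Real.exp 1 * (w : ℝ) * ((k : ℝ) + 1)) ^ (q + z) *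
        (n : ℝ) ^ (((t : ℝ) - (q : ℝ)) / 2)) ^ (2 * (k + 1)) := by
        rw [mul_pow _ ((n : ℝ) ^ (((t : ℝ) - (q : ℝ)) / 2)), hrpow]
        generalize (k : ℝ) + 1 = κ
        ring
    _ ≤ _ := by
        gcongr
        norm_num

theorem stmt14 (n x y z q : ℕ) (hn : 1 ≤ n)
    (H : SimpleGraph (Fin x ⊕ Fin y ⊕ Fin z)) [DecidableRel H.Adj]
    (hdeg : ∀ m : Fin z, 0 < H.degree (Sum.inr (Sum.inr m)))
    (hq : IsLeast {m | ∃ S, IsSep H S ∧ S.card = m} q) :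
    (1 ≤ q + z → ∀ ε : ℝ, 0 < ε → ε < 1 →
      Pr (fun g : Sym2 (Fin n) → Bool =>
          2 * ((x + y + z : ℕ) : ℝ) ^ (x + y + z) *
              (Real.exp 1 * ((x + y + 2 * z : ℕ) : ℝ) *
                (Real.log (8 * (n : ℝ) ^ q / ε) / (2 * ((q + z : ℕ) : ℝ)) + 1)) ^ (q + z) *
              (n : ℝ) ^ ((((x + y + z : ℕ) : ℝ) - (q : ℝ)) / 2)
            ≤ opNorm (RHgen H g)) ≤ ε) ∧
    (q = 0 → z = 0 → ∀ g : Sym2 (Fin n) → Bool,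
      opNorm (RHgen H g) ≤ (n : ℝ) ^ (((x + y + z : ℕ) : ℝ) / 2)) := by
  obtain ⟨⟨S₀, hS₀, hS₀q⟩, hmin⟩ := hq
  refine ⟨fun hqz ε hε hε1 => ?_, fun _ hz g => opNorm_RHgen_le_of_eq_zero H hz g⟩
  have hsep : ∀ S, IsSep H S → q ≤ S.card := fun S hS => hmin ⟨S, hS, rfl⟩
  have hqt : q ≤ x + y + z := by
    rw [← hS₀q]
    exact (card_le_univ S₀).trans (by simp [add_assoc])
  obtain ⟨r, hr⟩ := Nat.exists_eq_add_of_le hqt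
  have ht : 1 ≤ x + y + z := by omega
  set L := Real.log (8 * (n : ℝ) ^ q / ε) / (2 * ((q + z : ℕ) : ℝ)) with hLdef
  have hqz' : (0 : ℝ) < ((q + z : ℕ) : ℝ) := by exact_mod_cast hqz
  have hn1 : (1 : ℝ) ≤ (n : ℝ) ^ q := one_le_pow₀ (by exact_mod_cast hn)
  have hlog : 0 < Real.log (8 * (n : ℝ) ^ q / ε) := by
    refine Real.log_pos ?_
    rw [lt_div_iff₀ hε]
    linarith
  have hL : 0 < L := by positivity
  obtain ⟨k, hk⟩ := Nat.exists_eq_succ_of_ne_zero (Nat.ceil_pos.2 hL).ne'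
  have hk1 : L ≤ (k : ℝ) + 1 := by
    have := Nat.le_ceil L
    rw [hk] at this
    exact_mod_cast this
  have hk2 : (k : ℝ) + 1 ≤ L + 1 := by
    have := Nat.ceil_lt_add_one hL.le
    rw [hk] at this
    exact_mod_cast this.le
  have hw : 1 ≤ x + y + 2 * z := by omega
  have hbound := moment_bound_le_threshold (w := x + y + 2 * z) (z := z) hn hε hr hw hk2 (by
    rw [hLdef, div_le_iff₀ (by positivity)] at hk1
    linarith)
  have hn0 : (0 : ℝ) < n := by exact_mod_cast hn
  have ht0 : (0 : ℝ) < ((x + y + z : ℕ) : ℝ) := by exact_mod_cast ht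
  have hw0 : (0 : ℝ) < ((x + y + 2 * z : ℕ) : ℝ) := by exact_mod_cast hw
  refine Pr_le_of_sum_pow_le _ (by positivity) (2 * (k + 1)) (fun g => opNorm_nonneg _) ?_
  refine (sum_opNorm_RHgen_pow_le H hdeg hsep hr ht k).trans ?_
  rw [mul_left_comm, mul_comm (Nat.cast (Fintype.card (Sym2 (Fin n) → Bool)))]
  gcongr
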